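/- Let f be a Schwartz function on ℝ and set m₂(η) = 1/(2(4+η²)), m₃(η) = η/(2(1+η²)), m₄(η) = (2−η²)/((1+η²)(4+η²)), m₅(η) = −3η/(2(1+η²)(4+η²)), m₆(η) = −3/(2(1+η²)(4+η²)). Then J[f] is absolutely integrable on ℝ, and for every ξ ∈ ℝ: (2π)^{-1/2} ∫_ℝ e^{-ixξ} J[f](x) dx = m₄(ξ) f̂(ξ) + lim_{δ→0⁺} ∫_{|ξ−η| ≥ δ} m₅(η) cosech(π(ξ−η)/2) f̂(η) dη + ∫_ℝ κ(ξ−η) m₆(η) f̂(η) dη + κ(ξ) ∫_ℝ m₂(η) f̂(η) dη + ξ sech(πξ/2) ∫_ℝ m₃(η) f̂(η) dη, where κ(y) := y·cosech(πy/2) for y ≠ 0 and κ(0) := 2/π (the continuous extension), and the principal-value limit exists. -/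

import Mathlib

open MeasureTheory Filter Topology

noncomputable section

/-- `sech x = 1 / cosh x`. -/
def sech (x : ℝ) : ℝ := 1 / Real.cosh x

/-- `cosech x = 1 / sinh x`. -/
def csch (x : ℝ) : ℝ := 1 / Real.sinh x

/-- The Fourier transform `f̂(ξ) = (2π)^{-1/2} ∫ e^{-ixξ} f(x) dx`. -/
def FT (f : ℝ → ℂ) (ξ : ℝ) : ℂ :=
  (Real.sqrt (2 * Real.pi) : ℂ)⁻¹ * ∫ x : ℝ, Complex.exp (-(Complex.I * (x : ℂ) * (ξ : ℂ))) * f x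

/-- `I₁[g](x) = sech x ∫₀ˣ cosh y · g(y) dy`. -/
def I1op (g : ℝ → ℂ) (x : ℝ) : ℂ := (sech x : ℂ) * ∫ y in (0 : ℝ)..x, (Real.cosh y : ℂ) * g y

/-- `I₂[g](x) = sech² x ∫₀ˣ cosh² y · g(y) dy`. -/
def I2op (g : ℝ → ℂ) (x : ℝ) : ℂ :=
  (sech x : ℂ) ^ 2 * ∫ y in (0 : ℝ)..x, (Real.cosh y : ℂ) ^ 2 * g y

/-- `J[g] = I₂[I₁[g]]`. -/
def Jop (g : ℝ → ℂ) : ℝ → ℂ := I2op (I1op g)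

/-- `κ(y) = y cosech(πy/2)`, continuously extended by `2/π` at `y = 0`. -/
def Kker (y : ℝ) : ℝ := if y = 0 then 2 / Real.pi else y * csch (Real.pi * y / 2)

def m2 (η : ℝ) : ℝ := 1 / (2 * (4 + η ^ 2))
def m3 (η : ℝ) : ℝ := η / (2 * (1 + η ^ 2))
def m4 (η : ℝ) : ℝ := (2 - η ^ 2) / ((1 + η ^ 2) * (4 + η ^ 2))
def m5 (η : ℝ) : ℝ := -(3 * η) / (2 * (1 + η ^ 2) * (4 + η ^ 2))
def m6 (η : ℝ) : ℝ := -3 / (2 * (1 + η ^ 2) * (4 + η ^ 2))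

open scoped FourierTransform

/-- normalisation relation with the Mathlib Fourier transform -/
lemma FT_eq_fourier (g : ℝ → ℂ) (ξ : ℝ) :
    FT g ξ = (Real.sqrt (2 * Real.pi) : ℂ)⁻¹ * 𝓕 g (ξ / (2 * Real.pi)) := by
  unfold FT
  rw [Real.fourier_real_eq_integral_exp_smul]
  congr 1
  apply integral_congr_ae
  refine Eventually.of_forall fun x => ?_
  simp only [smul_eq_mul]
  congr 2
  have : (Real.pi : ℂ) ≠ 0 := by exact_mod_cast Real.pi_ne_zero
  push_cast
  field_simp

lemma sqrt_two_pi_sq : (Real.sqrt (2 * Real.pi) : ℂ) * (Real.sqrt (2 * Real.pi) : ℂ) = 2 * Real.pi := by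
  have := Real.mul_self_sqrt (show (0:ℝ) ≤ 2 * Real.pi by positivity)
  exact_mod_cast this

lemma sqrt_two_pi_ne : (Real.sqrt (2 * Real.pi) : ℂ) ≠ 0 := by
  have : Real.sqrt (2 * Real.pi) ≠ 0 := (Real.sqrt_pos.2 (by positivity)).ne'
  exact_mod_cast this

lemma FT_inversion (g : ℝ → ℂ) (hc : Continuous g) (hg : Integrable g) (hF : Integrable (FT g))
    (x : ℝ) :
    g x = (Real.sqrt (2 * Real.pi) : ℂ)⁻¹ *
      ∫ η : ℝ, Complex.exp (Complex.I * (x : ℂ) * (η : ℂ)) * FT g η := by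
  have hs := sqrt_two_pi_ne
  have hpi : (2 * Real.pi : ℝ) ≠ 0 := by positivity
  have h1 : ∀ w : ℝ, 𝓕 g w = (Real.sqrt (2 * Real.pi) : ℂ) * FT g (w * (2 * Real.pi)) := by
    intro w
    rw [FT_eq_fourier, mul_div_cancel_right₀ _ hpi, mul_inv_cancel_left₀ hs]
  have h2 : Integrable (𝓕 g) := by
    have : 𝓕 g = fun w : ℝ => (Real.sqrt (2 * Real.pi) : ℂ) * FT g (w * (2 * Real.pi)) := funext h1
    rw [this]
    exact (hF.comp_mul_right' hpi).const_mul _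
  have h3 := congrFun (hc.fourierInv_fourier_eq hg h2) x
  rw [← h3, Real.fourierInv_eq']
  have h4 : ∀ w : ℝ, Complex.exp (↑(2 * Real.pi * inner ℝ w x) * Complex.I) • 𝓕 g w =
      (fun η : ℝ => (Real.sqrt (2 * Real.pi) : ℂ) * (Complex.exp (Complex.I * (x : ℂ) * (η : ℂ)) * FT g η))
        (w * (2 * Real.pi)) := by
    intro w
    simp only [smul_eq_mul, h1]
    rw [mul_left_comm]
    congr 3
    simp
    ring
  rw [integral_congr_ae (Eventually.of_forall h4), Measure.integral_comp_mul_right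
      (fun η : ℝ => (Real.sqrt (2 * Real.pi) : ℂ) *
        (Complex.exp (Complex.I * (x : ℂ) * (η : ℂ)) * FT g η)) (2 * Real.pi),
    integral_const_mul]
  rw [abs_of_pos (by positivity), Complex.real_smul, ← mul_assoc]
  congr 1
  push_cast
  rw [← sqrt_two_pi_sq]
  field_simp

abbrev Dop : SchwartzMap ℝ ℂ →L[ℂ] SchwartzMap ℝ ℂ := SchwartzMap.derivCLM ℂ ℂ

lemma Dop_hasDerivAt (h : SchwartzMap ℝ ℂ) (x : ℝ) : HasDerivAt (⇑h) (Dop h x) x := by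
  simpa using h.hasDerivAt x

lemma FT_Dop (h : SchwartzMap ℝ ℂ) (ξ : ℝ) : FT (⇑(Dop h)) ξ = Complex.I * ξ * FT (⇑h) ξ := by
  have h0 : (⇑(Dop h)) = deriv (⇑h) := by ext x; simp
  have h1 := Real.fourier_deriv (f := ⇑h) h.integrable h.differentiable
    (by rw [← h0]; exact (Dop h).integrable)
  rw [h0, FT_eq_fourier, FT_eq_fourier, h1]
  have : (Real.pi : ℂ) ≠ 0 := by exact_mod_cast Real.pi_ne_zero
  simp only [smul_eq_mul]
  push_cast
  field_simp

lemma FT_schwartz_integrable (h : SchwartzMap ℝ ℂ) : Integrable (FT (⇑h)) := by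
  have : FT (⇑h) = fun ξ => (Real.sqrt (2 * Real.pi) : ℂ)⁻¹ * (𝓕 h) (ξ / (2 * Real.pi)) := by
    ext ξ; rw [FT_eq_fourier]; rfl
  rw [this]
  exact ((𝓕 h).integrable.comp_div (by positivity)).const_mul _

lemma FT_schwartz_continuous (h : SchwartzMap ℝ ℂ) : Continuous (FT (⇑h)) := by
  have : FT (⇑h) = fun ξ => (Real.sqrt (2 * Real.pi) : ℂ)⁻¹ * (𝓕 h) (ξ / (2 * Real.pi)) := by
    ext ξ; rw [FT_eq_fourier]; rfl
  rw [this]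
  have := (𝓕 h).continuous
  fun_prop

lemma FT_inv_schwartz (h : SchwartzMap ℝ ℂ) (x : ℝ) :
    h x = (Real.sqrt (2 * Real.pi) : ℂ)⁻¹ *
      ∫ η : ℝ, Complex.exp (Complex.I * (x : ℂ) * (η : ℂ)) * FT (⇑h) η :=
  FT_inversion _ h.continuous h.integrable (FT_schwartz_integrable h) x

lemma FT_schwartz_inj (h k : SchwartzMap ℝ ℂ) (hk : ∀ ξ, FT (⇑h) ξ = FT (⇑k) ξ) (x : ℝ) :
    h x = k x := by
  rw [FT_inv_schwartz h, FT_inv_schwartz k]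
  simp_rw [hk]

lemma FT_schwartz_add (h k : SchwartzMap ℝ ℂ) (ξ : ℝ) :
    FT (⇑(h + k)) ξ = FT (⇑h) ξ + FT (⇑k) ξ := by
  rw [FT_eq_fourier, FT_eq_fourier, FT_eq_fourier, ← SchwartzMap.fourier_coe,
    ← SchwartzMap.fourier_coe, ← SchwartzMap.fourier_coe, FourierTransform.fourier_add]
  simp [mul_add]

lemma FT_schwartz_smul (c : ℂ) (h : SchwartzMap ℝ ℂ) (ξ : ℝ) :
    FT (⇑(c • h)) ξ = c * FT (⇑h) ξ := by
  rw [FT_eq_fourier, FT_eq_fourier, ← SchwartzMap.fourier_coe,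
    ← SchwartzMap.fourier_coe, FourierTransform.fourier_smul]
  simp; ring

lemma temperate_q : Function.HasTemperateGrowth
    (fun w : ℝ => (1 + (2 * Real.pi * w) ^ 2)⁻¹ * (4 + (2 * Real.pi * w) ^ 2)⁻¹) := by
  have h0 := Function.hasTemperateGrowth_one_add_norm_sq_rpow ℝ (-1)
  have h1 : Function.HasTemperateGrowth (fun w : ℝ => 2 * Real.pi * w) := by fun_prop
  have h2 : Function.HasTemperateGrowth (fun w : ℝ => Real.pi * w) := by fun_prop
  have h3 := (h0.comp h1).mul ((Function.HasTemperateGrowth.const (1/4 : ℝ)).mul (h0.comp h2))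
  refine (congrArg Function.HasTemperateGrowth (funext fun w => ?_)).mpr h3
  simp only [Function.comp_apply, Pi.mul_apply, Real.rpow_neg_one, Real.norm_eq_abs, sq_abs]
  congr 1
  rw [one_div, ← mul_inv]
  congr 1
  ring

lemma exists_h (f : SchwartzMap ℝ ℂ) : ∃ h : SchwartzMap ℝ ℂ,
    ∀ ξ : ℝ, FT (⇑f) ξ = ((1 + ξ ^ 2) * (4 + ξ ^ 2)) * FT (⇑h) ξ := by
  refine ⟨SchwartzMap.fourierMultiplierCLM ℂ (fun w : ℝ => (1 + (2 * Real.pi * w) ^ 2)⁻¹ * (4 + (2 * Real.pi * w) ^ 2)⁻¹) f, fun ξ => ?_⟩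
  rw [FT_eq_fourier, FT_eq_fourier, ← SchwartzMap.fourier_coe, ← SchwartzMap.fourier_coe,
    SchwartzMap.fourierMultiplierCLM_apply, FourierTransform.fourier_fourierInv_eq,
    SchwartzMap.smulLeftCLM_apply_apply temperate_q]
  have h1 : (1 + (ξ:ℂ) ^ 2) ≠ 0 := by
    have : (1 + ξ ^ 2 : ℝ) ≠ 0 := by positivity
    exact_mod_cast this
  have h2 : (4 + (ξ:ℂ) ^ 2) ≠ 0 := by
    have : (4 + ξ ^ 2 : ℝ) ≠ 0 := by positivity
    exact_mod_cast this
  rw [mul_div_cancel₀ ξ (by positivity : (2 * Real.pi) ≠ 0), Complex.real_smul]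
  push_cast
  field_simp

lemma f_eq_h (f h : SchwartzMap ℝ ℂ)
    (hh : ∀ ξ : ℝ, FT (⇑f) ξ = ((1 + ξ ^ 2) * (4 + ξ ^ 2)) * FT (⇑h) ξ) (x : ℝ) :
    f x = Dop (Dop (Dop (Dop h))) x - 5 * Dop (Dop h) x + 4 * h x := by
  have := FT_schwartz_inj f (Dop (Dop (Dop (Dop h))) + ((-5 : ℂ) • Dop (Dop h) + (4:ℂ) • h)) ?_ x
  · rw [this]
    simp only [add_apply, smul_apply, smul_eq_mul]
    ring
  · intro ξ
    simp only [FT_schwartz_add, FT_schwartz_smul, FT_Dop, hh]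
    have hI : Complex.I ^ 2 = -1 := Complex.I_sq
    have hI4 : Complex.I ^ 4 = 1 := Complex.I_pow_four
    ring_nf
    rw [hI, hI4]
    ring

lemma hasDerivAt_coshC (x : ℝ) :
    HasDerivAt (fun y : ℝ => (Real.cosh y : ℂ)) (Real.sinh x : ℂ) x :=
  (Real.hasDerivAt_cosh x).ofReal_comp

lemma hasDerivAt_sinhC (x : ℝ) :
    HasDerivAt (fun y : ℝ => (Real.sinh y : ℂ)) (Real.cosh x : ℂ) x :=
  (Real.hasDerivAt_sinh x).ofReal_comp

lemma cosh_sqC (x : ℝ) : (Real.cosh x : ℂ) ^ 2 = (Real.sinh x : ℂ) ^ 2 + 1 := by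
  exact_mod_cast Real.cosh_sq x

lemma coshC_ne (x : ℝ) : (Real.cosh x : ℂ) ≠ 0 := by
  exact_mod_cast (Real.cosh_pos x).ne'

lemma continuous_coshC : Continuous fun y : ℝ => (Real.cosh y : ℂ) :=
  Complex.continuous_ofReal.comp Real.continuous_cosh

lemma continuous_sinhC : Continuous fun y : ℝ => (Real.sinh y : ℂ) :=
  Complex.continuous_ofReal.comp Real.continuous_sinh

lemma inner_integral (f h : SchwartzMap ℝ ℂ)
    (hf : ∀ x, f x = Dop (Dop (Dop (Dop h))) x - 5 * Dop (Dop h) x + 4 * h x) (y : ℝ) :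
    ∫ z in (0:ℝ)..y, (Real.cosh z : ℂ) * f z =
      (Real.sinh y : ℂ) * (4 * h y - Dop (Dop h) y)
        - (Real.cosh y : ℂ) * (4 * Dop h y - Dop (Dop (Dop h)) y)
        + (4 * Dop h 0 - Dop (Dop (Dop h)) 0) := by
  have hd : ∀ x ∈ Set.uIcc 0 y, HasDerivAt (fun y : ℝ => (Real.sinh y : ℂ) * (4 * h y - Dop (Dop h) y)
        - (Real.cosh y : ℂ) * (4 * Dop h y - Dop (Dop (Dop h)) y)) ((Real.cosh x : ℂ) * f x) x := by
    intro x _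
    have h0 := Dop_hasDerivAt h x
    have h1 := Dop_hasDerivAt (Dop h) x
    have h2 := Dop_hasDerivAt (Dop (Dop h)) x
    have h3 := Dop_hasDerivAt (Dop (Dop (Dop h))) x
    have := ((hasDerivAt_sinhC x).mul ((h0.const_mul 4).sub h2)).sub
      ((hasDerivAt_coshC x).mul ((h1.const_mul 4).sub h3))
    refine this.congr_deriv ?_
    simp only [Pi.sub_apply]
    rw [hf x]
    ring
  have hc : Continuous fun z : ℝ => (Real.cosh z : ℂ) * f z := continuous_coshC.mul f.continuous
  rw [intervalIntegral.integral_eq_sub_of_hasDerivAt hd (hc.intervalIntegrable _ _)]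
  simp
  ring

lemma Jop_formula (f h : SchwartzMap ℝ ℂ)
    (hf : ∀ x, f x = Dop (Dop (Dop (Dop h))) x - 5 * Dop (Dop h) x + 4 * h x) (x : ℝ) :
    Jop (⇑f) x = Dop (Dop h) x + 2 * h x - 3 * ((sech x ^ 2 : ℝ) : ℂ) * h x
      - 3 * (Real.tanh x : ℂ) * Dop h x
      + (h 0 - Dop (Dop h) 0) * ((sech x ^ 2 : ℝ) : ℂ)
      + (4 * Dop h 0 - Dop (Dop (Dop h)) 0) * ((sech x * Real.tanh x : ℝ) : ℂ) := by
  unfold Jop I2op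
  have e1 : ∀ y : ℝ, (Real.cosh y : ℂ) ^ 2 * I1op (⇑f) y = (Real.cosh y : ℂ) *
      ((Real.sinh y : ℂ) * (4 * h y - Dop (Dop h) y)
        - (Real.cosh y : ℂ) * (4 * Dop h y - Dop (Dop (Dop h)) y)
        + (4 * Dop h 0 - Dop (Dop (Dop h)) 0)) := by
    intro y
    unfold I1op
    rw [inner_integral f h hf y]
    have := coshC_ne y
    unfold sech
    push_cast [← Complex.ofReal_cosh]
    field_simp
  simp_rw [e1]
  set C := (4 * Dop h 0 - Dop (Dop (Dop h)) 0) with hC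
  have hd : ∀ y ∈ Set.uIcc 0 x, HasDerivAt (fun y : ℝ =>
      ((Real.cosh y : ℂ) * (Real.cosh y : ℂ)) * (Dop (Dop h) y + 2 * h y) - 3 * h y
        - 3 * (((Real.sinh y : ℂ) * (Real.cosh y : ℂ)) * Dop h y) + C * (Real.sinh y : ℂ))
      ((Real.cosh y : ℂ) *
      ((Real.sinh y : ℂ) * (4 * h y - Dop (Dop h) y)
        - (Real.cosh y : ℂ) * (4 * Dop h y - Dop (Dop (Dop h)) y) + C)) y := by
    intro y _
    have h0 := Dop_hasDerivAt h y
    have h1 := Dop_hasDerivAt (Dop h) y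
    have h2 := Dop_hasDerivAt (Dop (Dop h)) y
    have hch := hasDerivAt_coshC y
    have hsh := hasDerivAt_sinhC y
    have := ((((hch.mul hch).mul (h2.add (h0.const_mul 2))).sub (h0.const_mul 3)).sub
      (((hsh.mul hch).mul h1).const_mul 3)).add (hsh.const_mul C)
    refine this.congr_deriv ?_
    simp only [Pi.add_apply, Pi.mul_apply]
    have := cosh_sqC y
    linear_combination (3 * Dop h y) * this
  have hc : Continuous fun y : ℝ => ((Real.cosh y : ℂ) *
      ((Real.sinh y : ℂ) * (4 * h y - Dop (Dop h) y)
        - (Real.cosh y : ℂ) * (4 * Dop h y - Dop (Dop (Dop h)) y) + C)) := by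
    have := continuous_coshC
    have := continuous_sinhC
    have := h.continuous
    have := (Dop h).continuous
    have := (Dop (Dop h)).continuous
    have := (Dop (Dop (Dop h))).continuous
    fun_prop
  rw [intervalIntegral.integral_eq_sub_of_hasDerivAt hd (hc.intervalIntegrable _ _)]
  have := coshC_ne x
  unfold sech
  rw [Real.tanh_eq_sinh_div_cosh]
  push_cast [← Complex.ofReal_cosh, ← Complex.ofReal_sinh]
  simp only [Real.cosh_zero, Real.sinh_zero, Complex.ofReal_zero, Complex.ofReal_one]
  field_simp
  ring

lemma sigmoid_two_mul (x : ℝ) :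
    Real.sigmoid (2 * x) = Real.exp (x - Real.log (2 * Real.cosh x)) := by
  have hc := Real.cosh_pos x
  rw [Real.exp_sub, Real.exp_log (by positivity), Real.sigmoid_def, Real.cosh_eq,
    show -(2 * x) = -x + -x by ring, Real.exp_add, Real.exp_neg]
  have := Real.exp_pos x
  field_simp

lemma one_sub_sigmoid_two_mul (x : ℝ) :
    1 - Real.sigmoid (2 * x) = Real.exp (-x - Real.log (2 * Real.cosh x)) := by
  rw [← Real.sigmoid_neg, show -(2 * x) = 2 * (-x) by ring, sigmoid_two_mul, Real.cosh_neg]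

lemma beta_eq (a b : ℂ) :
    Complex.betaIntegral a b =
      ∫ x : ℝ, 2 * Complex.exp ((a - b) * x - (a + b) * (Real.log (2 * Real.cosh x) : ℂ)) := by
  have him : (fun x : ℝ => Real.sigmoid (2 * x)) '' Set.univ = Set.Ioo 0 1 := by
    rw [Set.image_univ, ← Real.range_sigmoid]
    ext y
    constructor
    · rintro ⟨x, rfl⟩; exact ⟨2 * x, rfl⟩
    · rintro ⟨x, rfl⟩; exact ⟨x / 2, by simp only []; congr 1; ring⟩
  have hd : ∀ x ∈ (Set.univ : Set ℝ), HasDerivWithinAt (fun x : ℝ => Real.sigmoid (2 * x))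
      (2 * (Real.sigmoid (2 * x) * (1 - Real.sigmoid (2 * x)))) Set.univ x := by
    intro x _
    have h1 : HasDerivAt (fun x : ℝ => 2 * x) 2 x := by simpa using (hasDerivAt_id x).const_mul 2
    have := (Real.hasDerivAt_sigmoid (2 * x)).comp x h1
    refine HasDerivAt.hasDerivWithinAt (this.congr_deriv ?_)
    ring
  have hinj : Set.InjOn (fun x : ℝ => Real.sigmoid (2 * x)) Set.univ := by
    intro x _ y _ hxy
    have := Real.sigmoid_injective hxy
    linarith
  unfold Complex.betaIntegral
  rw [intervalIntegral.integral_of_le zero_le_one, integral_Ioc_eq_integral_Ioo, ← him,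
    integral_image_eq_integral_abs_deriv_smul MeasurableSet.univ hd hinj, Measure.restrict_univ]
  apply integral_congr_ae
  refine Eventually.of_forall fun x => ?_
  simp only []
  have e1 : (1 : ℂ) - (Real.sigmoid (2 * x) : ℂ) =
    (Real.exp (-x - Real.log (2 * Real.cosh x)) : ℂ) := by
    rw [← one_sub_sigmoid_two_mul]; push_cast; rfl
  have e0 : ∀ (r : ℝ) (s : ℂ), (Real.exp r : ℂ) ^ s = Complex.exp (r * s) := by
    intro r s
    rw [Complex.cpow_def_of_ne_zero (by exact_mod_cast (Real.exp_pos r).ne'),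
      ← Complex.ofReal_log (Real.exp_pos r).le, Real.log_exp]
  rw [e1, one_sub_sigmoid_two_mul, sigmoid_two_mul, e0, e0, abs_of_pos (by positivity),
    Complex.real_smul]
  simp only [Complex.ofReal_mul, Complex.ofReal_exp]
  push_cast
  rw [mul_assoc, mul_assoc, ← Complex.exp_add, ← Complex.exp_add, ← Complex.exp_add]
  congr 2
  ring

lemma exp_neg_log_two_cosh (x : ℝ) :
    Complex.exp (-(Real.log (2 * Real.cosh x) : ℂ)) = (sech x : ℂ) / 2 := by
  have hc := Real.cosh_pos x
  rw [← Complex.ofReal_neg, ← Complex.ofReal_exp, Real.exp_neg, Real.exp_log (by positivity)]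
  unfold sech
  push_cast
  field_simp

lemma sech_ft (ξ : ℝ) :
    ∫ x : ℝ, Complex.exp (-(Complex.I * (x : ℂ) * (ξ : ℂ))) * (sech x : ℂ)
      = Real.pi * (sech (Real.pi * ξ / 2) : ℂ) := by
  have hb := beta_eq ((1 - Complex.I * ξ) / 2) ((1 + Complex.I * ξ) / 2)
  rw [Complex.betaIntegral_eq_Gamma_mul_div _ _ (by simp) (by simp),
    show (1 - Complex.I * ξ) / 2 + (1 + Complex.I * ξ) / 2 = 1 by ring, Complex.Gamma_one, div_one,
    show (1 + Complex.I * ξ) / 2 = 1 - (1 - Complex.I * ξ) / 2 by ring,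
    Complex.Gamma_mul_Gamma_one_sub] at hb
  have hs : Complex.sin (Real.pi * ((1 - Complex.I * ξ) / 2)) = (Real.cosh (Real.pi * ξ / 2) : ℂ) := by
    rw [show (Real.pi : ℂ) * ((1 - Complex.I * ξ) / 2) =
      Real.pi / 2 - ((Real.pi * ξ / 2 : ℝ) : ℂ) * Complex.I by push_cast; ring,
      Complex.sin_pi_div_two_sub, Complex.cos_mul_I]
    push_cast; rfl
  rw [hs] at hb
  have : Real.pi * (sech (Real.pi * ξ / 2) : ℂ) = Real.pi / (Real.cosh (Real.pi * ξ / 2) : ℂ) := by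
    unfold sech; push_cast; ring
  rw [this, hb]
  apply integral_congr_ae
  refine Eventually.of_forall fun x => ?_
  simp only []
  rw [show ((1 - Complex.I * ξ) / 2 - (1 - (1 - Complex.I * ξ) / 2)) * (x : ℂ)
    - 1 * (Real.log (2 * Real.cosh x) : ℂ) = -(Complex.I * x * ξ) + -(Real.log (2 * Real.cosh x) : ℂ)
    by ring, Complex.exp_add, exp_neg_log_two_cosh]
  ring

lemma sech_sq_ft (ξ : ℝ) :
    ∫ x : ℝ, Complex.exp (-(Complex.I * (x : ℂ) * (ξ : ℂ))) * ((sech x ^ 2 : ℝ) : ℂ)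
      = Real.pi * (Kker ξ : ℂ) := by
  have hb := beta_eq (1 - Complex.I * ξ / 2) (1 + Complex.I * ξ / 2)
  rw [Complex.betaIntegral_eq_Gamma_mul_div _ _ (by simp) (by simp),
    show (1 - Complex.I * ξ / 2) + (1 + Complex.I * ξ / 2) = 2 by ring,
    Complex.Gamma_ofNat_eq_factorial] at hb
  have hr : ∫ x : ℝ, Complex.exp (-(Complex.I * (x : ℂ) * (ξ : ℂ))) * ((sech x ^ 2 : ℝ) : ℂ) =
      2 * (Complex.Gamma (1 - Complex.I * ξ / 2) * Complex.Gamma (1 + Complex.I * ξ / 2)) := by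
    have : Complex.Gamma (1 - Complex.I * ξ / 2) * Complex.Gamma (1 + Complex.I * ξ / 2) =
      ∫ x : ℝ, (1 / 2 : ℂ) *
        (Complex.exp (-(Complex.I * (x : ℂ) * (ξ : ℂ))) * ((sech x ^ 2 : ℝ) : ℂ)) := by
      simp at hb
      rw [hb]
      apply integral_congr_ae
      refine Eventually.of_forall fun x => ?_
      simp only []
      rw [show (1 - Complex.I * ξ / 2 - (1 + Complex.I * ξ / 2)) * (x : ℂ)
        - 2 * (Real.log (2 * Real.cosh x) : ℂ) = -(Complex.I * x * ξ) +
          (-(Real.log (2 * Real.cosh x) : ℂ) + -(Real.log (2 * Real.cosh x) : ℂ))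
        by ring, Complex.exp_add, Complex.exp_add, exp_neg_log_two_cosh]
      push_cast
      ring
    rw [this, integral_const_mul]
    ring
  rw [hr]
  have hpi : (Real.pi : ℂ) ≠ 0 := by exact_mod_cast Real.pi_ne_zero
  by_cases h0 : ξ = 0
  · subst h0
    simp [Kker]
    field_simp
  · have hs : Complex.I * ξ / 2 ≠ 0 := by
      simp [h0]
    have hsin : Complex.sin (Real.pi * (Complex.I * ξ / 2)) =
        (Real.sinh (Real.pi * ξ / 2) : ℂ) * Complex.I := by
      rw [show (Real.pi : ℂ) * (Complex.I * ξ / 2) =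
        ((Real.pi * ξ / 2 : ℝ) : ℂ) * Complex.I by push_cast; ring, Complex.sin_mul_I]
      push_cast; rfl
    have hsh : (Real.sinh (Real.pi * ξ / 2) : ℂ) ≠ 0 := by
      have : Real.sinh (Real.pi * ξ / 2) ≠ 0 := by
        rw [Ne, Real.sinh_eq_zero]
        have := Real.pi_ne_zero
        simp [h0, this]
      exact_mod_cast this
    rw [add_comm (1 : ℂ), Complex.Gamma_add_one _ hs,
      show ∀ A B s : ℂ, 2 * (A * (s * B)) = 2 * s * (B * A) from fun _ _ _ => by ring,
      Complex.Gamma_mul_Gamma_one_sub, hsin]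
    have hI := Complex.I_ne_zero
    simp only [Kker, h0, if_false, csch]
    push_cast [← Complex.ofReal_sinh]
    field_simp

lemma abs_le_abs_sinh (x : ℝ) : |x| ≤ |Real.sinh x| := by
  rw [Real.abs_sinh]
  exact Real.self_le_sinh_iff.2 (abs_nonneg x)

lemma one_add_sq_le_cosh (x : ℝ) : 1 + x ^ 2 / 2 ≤ Real.cosh x := by
  have h1 : Real.cosh x = 1 + 2 * Real.sinh (x / 2) ^ 2 := by
    have := Real.cosh_two_mul (x / 2)
    rw [show 2 * (x / 2) = x by ring] at this
    rw [this, Real.cosh_sq]; ring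
  have h2 := sq_le_sq.2 (abs_le_abs_sinh (x / 2))
  rw [h1]; nlinarith

lemma sech_pos (x : ℝ) : 0 < sech x := by
  unfold sech; have := Real.cosh_pos x; positivity

lemma sech_le (x : ℝ) : sech x ≤ 2 * (1 + x ^ 2)⁻¹ := by
  unfold sech
  have := one_add_sq_le_cosh x
  rw [← div_eq_mul_inv, div_le_div_iff₀ (Real.cosh_pos x) (by positivity)]
  nlinarith

lemma sech_le_one (x : ℝ) : sech x ≤ 1 := by
  unfold sech
  rw [div_le_one (Real.cosh_pos x)]
  exact Real.one_le_cosh x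

lemma continuous_sech : Continuous sech :=
  continuous_const.div Real.continuous_cosh fun x => (Real.cosh_pos x).ne'

lemma integrable_sech : Integrable sech :=
  (integrable_inv_one_add_sq.const_mul 2).mono' continuous_sech.aestronglyMeasurable
    (Eventually.of_forall fun x => by
      rw [Real.norm_eq_abs, abs_of_pos (sech_pos x)]; exact sech_le x)

lemma integrable_sech_sq : Integrable (fun x => sech x ^ 2) :=
  integrable_sech.mono' (continuous_sech.pow 2).aestronglyMeasurable
    (Eventually.of_forall fun x => by
      rw [Real.norm_eq_abs, abs_of_pos (by have := sech_pos x; positivity)]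
      nlinarith [sech_pos x, sech_le_one x])

lemma abs_tanh_le (x : ℝ) : |Real.tanh x| ≤ 1 := by
  rw [Real.tanh_eq_sinh_div_cosh, abs_div, abs_of_pos (Real.cosh_pos x),
    div_le_one (Real.cosh_pos x), Real.abs_sinh, ← Real.cosh_abs]
  exact (Real.sinh_lt_cosh _).le

lemma hasDerivAt_tanh' (x : ℝ) : HasDerivAt Real.tanh (sech x ^ 2) x := by
  have h : Real.tanh = fun x => Real.sinh x / Real.cosh x := funext Real.tanh_eq_sinh_div_cosh
  have hc := (Real.cosh_pos x).ne'
  rw [h]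
  refine ((Real.hasDerivAt_sinh x).div (Real.hasDerivAt_cosh x) hc).congr_deriv ?_
  have := Real.cosh_sq x
  unfold sech
  field_simp
  linarith

lemma continuous_tanh' : Continuous Real.tanh :=
  continuous_iff_continuousAt.2 fun x => (hasDerivAt_tanh' x).continuousAt

lemma hasDerivAt_sech (x : ℝ) : HasDerivAt sech (-(sech x * Real.tanh x)) x := by
  have hc := (Real.cosh_pos x).ne'
  refine ((hasDerivAt_const x (1:ℝ)).div (Real.hasDerivAt_cosh x) hc).congr_deriv ?_
  rw [Real.tanh_eq_sinh_div_cosh]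
  unfold sech
  field_simp
  ring

lemma integrable_sech_tanh : Integrable (fun x => sech x * Real.tanh x) :=
  integrable_sech.mono' (continuous_sech.mul continuous_tanh').aestronglyMeasurable
    (Eventually.of_forall fun x => by
      rw [Real.norm_eq_abs, abs_mul, abs_of_pos (sech_pos x)]
      nlinarith [sech_pos x, abs_tanh_le x])

lemma measurable_csch : Measurable csch := by
  unfold csch
  exact measurable_const.div Real.continuous_sinh.measurable

lemma measurable_Kker : Measurable Kker := by
  unfold Kker
  refine Measurable.ite (measurableSet_singleton (0:ℝ)) measurable_const ?_
  exact measurable_id.mul (measurable_csch.comp (by fun_prop))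

lemma mul_csch_le (t : ℝ) : |t * csch (Real.pi * t / 2)| ≤ 4 * (1 + t ^ 2)⁻¹ := by
  by_cases h0 : t = 0
  · subst h0; simp
  unfold csch
  have hpi := Real.pi_gt_three
  have hs : |Real.sinh (Real.pi * t / 2)| ≥ |t| * (1 + t ^ 2 / 4) := by
    rw [show Real.pi * t / 2 = 2 * (Real.pi * t / 4) by ring, Real.sinh_two_mul, abs_mul, abs_mul,
      abs_of_pos (Real.cosh_pos _), abs_two]
    have h1 := abs_le_abs_sinh (Real.pi * t / 4)
    have h2 := one_add_sq_le_cosh (Real.pi * t / 4)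
    have h3 : |t| ≤ 2 * |Real.pi * t / 4| := by
      rw [abs_div, abs_mul, abs_of_pos Real.pi_pos, abs_of_pos (by norm_num : (0:ℝ) < 4)]
      nlinarith [abs_nonneg t]
    have h4 : 1 + t ^ 2 / 4 ≤ Real.cosh (Real.pi * t / 4) := by
      refine le_trans ?_ h2
      nlinarith [sq_nonneg t, mul_nonneg (sq_nonneg t) (by nlinarith : (0:ℝ) ≤ Real.pi ^ 2 - 8)]
    exact mul_le_mul (by linarith) h4 (by positivity) (by positivity)
  have ht : 0 < |t| := abs_pos.2 h0
  rw [abs_mul, abs_div, abs_one, mul_one_div, ← div_eq_mul_inv]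
  have hp : 0 < |Real.sinh (Real.pi * t / 2)| := lt_of_lt_of_le (by positivity) hs
  rw [div_le_div_iff₀ hp (by positivity)]
  nlinarith [sq_nonneg t]

lemma Kker_eq (t : ℝ) (ht : t ≠ 0) : Kker t = t * csch (Real.pi * t / 2) := by
  simp [Kker, ht]

lemma Kker_le (t : ℝ) : |Kker t| ≤ 4 * (1 + t ^ 2)⁻¹ := by
  by_cases h0 : t = 0
  · subst h0
    simp only [Kker, if_true]
    have hpi := Real.pi_gt_three
    rw [abs_of_pos (by positivity), div_le_iff₀ (by positivity)]
    norm_num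
    linarith
  · rw [Kker_eq t h0]; exact mul_csch_le t

lemma integrable_Kker : Integrable Kker :=
  (integrable_inv_one_add_sq.const_mul 4).mono' measurable_Kker.aestronglyMeasurable
    (Eventually.of_forall fun x => by rw [Real.norm_eq_abs]; exact Kker_le x)

lemma norm_cexp_neg (x ξ : ℝ) : ‖Complex.exp (-(Complex.I * (x : ℂ) * (ξ : ℂ)))‖ = 1 := by
  rw [show -(Complex.I * (x : ℂ) * (ξ : ℂ)) = ((-(x * ξ) : ℝ) : ℂ) * Complex.I by push_cast; ring]
  exact Complex.norm_exp_ofReal_mul_I _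

lemma norm_cexp_pos (x ξ : ℝ) : ‖Complex.exp (Complex.I * (x : ℂ) * (ξ : ℂ))‖ = 1 := by
  rw [show (Complex.I * (x : ℂ) * (ξ : ℂ)) = ((x * ξ : ℝ) : ℂ) * Complex.I by push_cast; ring]
  exact Complex.norm_exp_ofReal_mul_I _

lemma FT_integrand_integrable {g : ℝ → ℂ} (hg : Integrable g) (ξ : ℝ) :
    Integrable (fun x : ℝ => Complex.exp (-(Complex.I * (x : ℂ) * (ξ : ℂ))) * g x) := by
  refine hg.bdd_mul (c := 1) ?_ ?_
  · exact (by fun_prop : Continuous fun x : ℝ =>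
      Complex.exp (-(Complex.I * (x : ℂ) * (ξ : ℂ)))).aestronglyMeasurable
  · exact Eventually.of_forall fun x => (norm_cexp_neg x ξ).le

lemma FT_add' {g k : ℝ → ℂ} (hg : Integrable g) (hk : Integrable k) (ξ : ℝ) :
    FT (fun x => g x + k x) ξ = FT g ξ + FT k ξ := by
  unfold FT
  simp_rw [mul_add]
  rw [integral_add (FT_integrand_integrable hg ξ) (FT_integrand_integrable hk ξ), mul_add]

lemma FT_const_mul' (c : ℂ) (g : ℝ → ℂ) (ξ : ℝ) :
    FT (fun x => c * g x) ξ = c * FT g ξ := by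
  unfold FT
  simp_rw [mul_left_comm _ c]
  rw [integral_const_mul]
  ring

lemma FT_sech_sq (ξ : ℝ) : FT (fun x => ((sech x ^ 2 : ℝ) : ℂ)) ξ =
    (Real.sqrt (2 * Real.pi) : ℂ)⁻¹ * (Real.pi * (Kker ξ : ℂ)) := by
  unfold FT
  rw [sech_sq_ft]

lemma FT_deriv' {g g' : ℝ → ℂ} (hg : Integrable g) (hd : ∀ x, HasDerivAt g (g' x) x)
    (hg' : Integrable g') (ξ : ℝ) : FT g' ξ = Complex.I * ξ * FT g ξ := by
  have h0 : g' = deriv g := by ext x; exact (hd x).deriv.symm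
  have h1 := Real.fourier_deriv (f := g) hg (fun x => (hd x).differentiableAt)
    (by rw [← h0]; exact hg')
  rw [h0, FT_eq_fourier, FT_eq_fourier, h1]
  have : (Real.pi : ℂ) ≠ 0 := by exact_mod_cast Real.pi_ne_zero
  simp only [smul_eq_mul]
  push_cast
  field_simp

lemma FT_sech_tanh (ξ : ℝ) : FT (fun x => ((sech x * Real.tanh x : ℝ) : ℂ)) ξ =
    -(Complex.I * ξ * ((Real.sqrt (2 * Real.pi) : ℂ)⁻¹ *
      (Real.pi * (sech (Real.pi * ξ / 2) : ℂ)))) := by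
  have h := FT_deriv' (g := fun x => (sech x : ℂ)) (g' := fun x => ((-(sech x * Real.tanh x) : ℝ) : ℂ))
    integrable_sech.ofReal (fun x => (hasDerivAt_sech x).ofReal_comp) integrable_sech_tanh.neg.ofReal ξ
  have h2 : FT (fun x => ((-(sech x * Real.tanh x) : ℝ) : ℂ)) ξ =
      -FT (fun x => ((sech x * Real.tanh x : ℝ) : ℂ)) ξ := by
    have := FT_const_mul' (-1) (fun x => ((sech x * Real.tanh x : ℝ) : ℂ)) ξ
    rw [neg_one_mul] at this
    rw [← this]
    congr 1
    ext x
    push_cast; ring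
  have h3 : FT (fun x => (sech x : ℂ)) ξ = (Real.sqrt (2 * Real.pi) : ℂ)⁻¹ *
      (Real.pi * (sech (Real.pi * ξ / 2) : ℂ)) := by
    unfold FT; rw [sech_ft]
  rw [h2, h3] at h
  rw [← h, neg_neg]

lemma Kker_inversion (x : ℝ) :
    ∫ t : ℝ, Complex.exp (Complex.I * (x : ℂ) * (t : ℂ)) * (Kker t : ℂ) = 2 * ((sech x ^ 2 : ℝ) : ℂ) := by
  have hF : FT (fun x => ((sech x ^ 2 : ℝ) : ℂ)) = fun ξ =>
    (Real.sqrt (2 * Real.pi) : ℂ)⁻¹ * (Real.pi * (Kker ξ : ℂ)) := funext FT_sech_sq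
  have h := FT_inversion (fun x => ((sech x ^ 2 : ℝ) : ℂ))
    (Complex.continuous_ofReal.comp (continuous_sech.pow 2)) integrable_sech_sq.ofReal
    (by rw [hF]; exact (integrable_Kker.ofReal.const_mul _).const_mul _) x
  rw [hF] at h
  rw [h]
  have e : ∀ t : ℝ, Complex.exp (Complex.I * (x : ℂ) * (t : ℂ)) *
      ((Real.sqrt (2 * Real.pi) : ℂ)⁻¹ * (Real.pi * (Kker t : ℂ))) =
      ((Real.sqrt (2 * Real.pi) : ℂ)⁻¹ * Real.pi) *
        (Complex.exp (Complex.I * (x : ℂ) * (t : ℂ)) * (Kker t : ℂ)) := fun t => by ring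
  simp_rw [e]
  rw [integral_const_mul]
  have hs := sqrt_two_pi_ne
  have h2 := sqrt_two_pi_sq
  have hpi : (Real.pi : ℂ) ≠ 0 := by exact_mod_cast Real.pi_ne_zero
  generalize (∫ t : ℝ, Complex.exp (Complex.I * (x : ℂ) * (t : ℂ)) * (Kker t : ℂ)) = A
  field_simp
  rw [pow_two, h2]
  ring

lemma Kker_cos (x : ℝ) : ∫ t : ℝ, Kker t * Real.cos (x * t) = 2 * sech x ^ 2 := by
  have h := congrArg Complex.re (Kker_inversion x)
  have hi : Integrable (fun t : ℝ => Complex.exp (Complex.I * (x : ℂ) * (t : ℂ)) * (Kker t : ℂ)) := by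
    refine integrable_Kker.ofReal.bdd_mul (c := 1) ?_ ?_
    · exact (by fun_prop : Continuous fun t : ℝ =>
        Complex.exp ((Complex.I * (x : ℂ) * (t : ℂ)))).aestronglyMeasurable
    · exact Eventually.of_forall fun t => (norm_cexp_pos x t).le
  have h2 : (2 * ((sech x ^ 2 : ℝ) : ℂ)).re = 2 * sech x ^ 2 := by
    rw [show (2 * ((sech x ^ 2 : ℝ) : ℂ)) = ((2 * sech x ^ 2 : ℝ) : ℂ) by push_cast; ring]
    exact Complex.ofReal_re _
  have h1 := integral_re (𝕜 := ℂ) hi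
  simp only [RCLike.re_eq_complex_re] at h1
  rw [h2, ← h1] at h
  rw [← h]
  apply integral_congr_ae
  refine Eventually.of_forall fun t => ?_
  simp only []
  rw [Complex.re_mul_ofReal, show (Complex.I * (x : ℂ) * (t : ℂ)) = ((x * t : ℝ) : ℂ) * Complex.I by
    push_cast; ring, Complex.exp_ofReal_mul_I_re]
  ring

lemma csch_sin_le (x t : ℝ) :
    |csch (Real.pi * t / 2) * Real.sin (x * t)| ≤ |x| * |Kker t| := by
  by_cases h0 : t = 0
  · subst h0; simp; positivity
  rw [Kker_eq t h0, abs_mul, abs_mul]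
  have := Real.abs_sin_le_abs (x := x * t)
  rw [abs_mul] at this
  nlinarith [mul_le_mul_of_nonneg_left this (abs_nonneg (csch (Real.pi * t / 2)))]

lemma csch_sin_integral (x : ℝ) :
    ∫ t : ℝ, csch (Real.pi * t / 2) * Real.sin (x * t) = 2 * Real.tanh x := by
  have hm : ∀ x : ℝ, AEStronglyMeasurable
      (fun t : ℝ => csch (Real.pi * t / 2) * Real.sin (x * t)) volume := fun x =>
    ((measurable_csch.comp (by fun_prop)).mul
      (by fun_prop : Measurable fun t : ℝ => Real.sin (x * t))).aestronglyMeasurable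
  have hi : ∀ x : ℝ, Integrable (fun t : ℝ => csch (Real.pi * t / 2) * Real.sin (x * t)) := fun x =>
    (integrable_Kker.abs.const_mul |x|).mono' (hm x)
      (Eventually.of_forall fun t => csch_sin_le x t)
  have hD : ∀ x : ℝ, HasDerivAt
      (fun x : ℝ => ∫ t : ℝ, csch (Real.pi * t / 2) * Real.sin (x * t)) (2 * sech x ^ 2) x := by
    intro x
    have := (hasDerivAt_integral_of_dominated_loc_of_deriv_le (μ := volume)
      (F := fun (x t : ℝ) => csch (Real.pi * t / 2) * Real.sin (x * t))
      (F' := fun (x t : ℝ) => csch (Real.pi * t / 2) * (Real.cos (x * t) * t))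
      (x₀ := x) (s := Set.univ) (bound := fun t => |Kker t|) univ_mem
      (Eventually.of_forall hm) (hi x) ?_ ?_ integrable_Kker.abs ?_).2
    · refine this.congr_deriv ?_
      rw [← Kker_cos x]
      apply integral_congr_ae
      have h0 : ∀ᵐ t : ℝ, t ≠ 0 := by
        simp [ae_iff]
      filter_upwards [h0] with t ht
      rw [Kker_eq t ht]; ring
    · exact ((measurable_csch.comp (by fun_prop)).mul
        (by fun_prop : Measurable fun t : ℝ => Real.cos (x * t) * t)).aestronglyMeasurable
    · refine Eventually.of_forall fun t y _ => ?_
      by_cases h0 : t = 0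
      · subst h0; simp
      rw [Kker_eq t h0, Real.norm_eq_abs, abs_mul, abs_mul, abs_mul]
      have := Real.abs_cos_le_one (y * t)
      nlinarith [mul_nonneg (abs_nonneg t) (abs_nonneg (csch (Real.pi * t / 2)))]
    · refine Eventually.of_forall fun t y _ => ?_
      have h1 : HasDerivAt (fun y : ℝ => y * t) t y := by
        simpa using (hasDerivAt_id y).mul_const t
      exact (h1.sin).const_mul _
  have hc : ∀ a b : ℝ, (fun x : ℝ => (∫ t : ℝ, csch (Real.pi * t / 2) * Real.sin (x * t)) - 2 * Real.tanh x) a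
      = (fun x : ℝ => (∫ t : ℝ, csch (Real.pi * t / 2) * Real.sin (x * t)) - 2 * Real.tanh x) b := by
    apply is_const_of_deriv_eq_zero
    · intro y
      exact ((hD y).sub ((hasDerivAt_tanh' y).const_mul 2)).differentiableAt
    · intro y
      refine ((hD y).sub ((hasDerivAt_tanh' y).const_mul 2)).deriv.trans ?_
      ring
  have := hc x 0
  simp at this
  linarith

/-- convolution formula for the transform of `sech² h` -/
lemma FT_sech_sq_mul (h : SchwartzMap ℝ ℂ) (ξ : ℝ) :
    FT (fun x => ((sech x ^ 2 : ℝ) : ℂ) * h x) ξ =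
      (1 / 2 : ℂ) * ∫ η : ℝ, (Kker (ξ - η) : ℂ) * FT (⇑h) η := by
  have hprodint : Integrable (fun p : ℝ × ℝ => Complex.exp (-(Complex.I * (p.1 : ℂ) * ((ξ - p.2 : ℝ) : ℂ))) *
      (((sech p.1 ^ 2 : ℝ) : ℂ) * FT (⇑h) p.2)) (volume.prod volume) := by
    refine (integrable_sech_sq.ofReal.mul_prod (FT_schwartz_integrable h)).bdd_mul (c := 1) ?_ ?_
    · exact (by fun_prop : Continuous fun p : ℝ × ℝ =>
        Complex.exp (-(Complex.I * (p.1 : ℂ) * ((ξ - p.2 : ℝ) : ℂ)))).aestronglyMeasurable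
    · exact Eventually.of_forall fun p => (norm_cexp_neg p.1 (ξ - p.2)).le
  have hsw := integral_integral_swap (f := fun x η : ℝ =>
    Complex.exp (-(Complex.I * (x : ℂ) * ((ξ - η : ℝ) : ℂ))) *
      (((sech x ^ 2 : ℝ) : ℂ) * FT (⇑h) η)) hprodint
  have e1 : ∀ x : ℝ, Complex.exp (-(Complex.I * (x : ℂ) * (ξ : ℂ))) * (((sech x ^ 2 : ℝ) : ℂ) * h x) =
      (Real.sqrt (2 * Real.pi) : ℂ)⁻¹ * ∫ η : ℝ,
        Complex.exp (-(Complex.I * (x : ℂ) * ((ξ - η : ℝ) : ℂ))) * (((sech x ^ 2 : ℝ) : ℂ) * FT (⇑h) η) := by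
    intro x
    rw [FT_inv_schwartz h x, mul_left_comm _ (Real.sqrt (2 * Real.pi) : ℂ)⁻¹, mul_left_comm _ (Real.sqrt (2 * Real.pi) : ℂ)⁻¹,
      ← integral_const_mul, ← integral_const_mul]
    congr 1
    apply integral_congr_ae
    refine Eventually.of_forall fun η => ?_
    simp only []
    rw [show -(Complex.I * (x : ℂ) * ((ξ - η : ℝ) : ℂ)) = -(Complex.I * (x : ℂ) * (ξ : ℂ)) +
      Complex.I * (x : ℂ) * (η : ℂ) by push_cast; ring, Complex.exp_add]
    ring
  have e2 : ∀ η : ℝ, ∫ x : ℝ, Complex.exp (-(Complex.I * (x : ℂ) * ((ξ - η : ℝ) : ℂ))) *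
      (((sech x ^ 2 : ℝ) : ℂ) * FT (⇑h) η) = Real.pi * ((Kker (ξ - η) : ℂ) * FT (⇑h) η) := by
    intro η
    simp_rw [← mul_assoc]
    rw [integral_mul_const, sech_sq_ft]
  have e0 : FT (fun x => ((sech x ^ 2 : ℝ) : ℂ) * h x) ξ = (Real.sqrt (2 * Real.pi) : ℂ)⁻¹ *
      ∫ x : ℝ, Complex.exp (-(Complex.I * (x : ℂ) * (ξ : ℂ))) * (((sech x ^ 2 : ℝ) : ℂ) * h x) := rfl
  rw [e0]
  simp_rw [e1]
  rw [integral_const_mul, hsw]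
  simp_rw [e2]
  rw [integral_const_mul, ← mul_assoc, ← mul_assoc]
  congr 1
  have hs := sqrt_two_pi_ne
  have h2 := sqrt_two_pi_sq
  have hpi : (Real.pi : ℂ) ≠ 0 := by exact_mod_cast Real.pi_ne_zero
  rw [← mul_inv, h2]
  field_simp

lemma PV_tanh (g : SchwartzMap ℝ ℂ) (ξ : ℝ) :
    Tendsto (fun δ : ℝ => ∫ η in {η : ℝ | δ ≤ |ξ - η|},
        (csch (Real.pi * (ξ - η) / 2) : ℂ) * FT (⇑g) η) (𝓝[>] (0 : ℝ))
      (𝓝 (2 * Complex.I * FT (fun x => (Real.tanh x : ℂ) * g x) ξ)) := by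
  set c : ℂ := (Real.sqrt (2 * Real.pi) : ℂ)⁻¹ with hc
  set G := FT (⇑g) with hG
  have hGi : Integrable G := FT_schwartz_integrable g
  have hGc : Continuous G := FT_schwartz_continuous g
  -- the product kernel
  set Ψ : ℝ → ℝ → ℂ := fun t x => ((csch (Real.pi * t / 2) * Real.sin (x * t) : ℝ) : ℂ) *
    (Complex.exp (-(Complex.I * (x : ℂ) * (ξ : ℂ))) * g x) with hΨ
  have hxg : Integrable (fun x : ℝ => |x| * ‖g x‖) := by
    have := g.integrable_pow_mul volume 1
    simpa using this
  have hΨi : Integrable (Function.uncurry Ψ) (volume.prod volume) := by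
    have hb := integrable_Kker.abs.mul_prod hxg
    refine hb.mono' ?_ (Eventually.of_forall fun p => ?_)
    · refine AEStronglyMeasurable.mul ?_ ?_
      · have : Measurable fun p : ℝ × ℝ => csch (Real.pi * p.1 / 2) * Real.sin (p.2 * p.1) :=
          (measurable_csch.comp (by fun_prop)).mul (by fun_prop)
        exact (Complex.measurable_ofReal.comp this).aestronglyMeasurable
      · have := g.continuous
        exact (by fun_prop : Continuous fun p : ℝ × ℝ =>
          Complex.exp (-(Complex.I * (p.2 : ℂ) * (ξ : ℂ))) * g p.2).aestronglyMeasurable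
    · simp only [Function.uncurry, hΨ]
      rw [norm_mul, norm_mul, norm_cexp_neg, one_mul, Complex.norm_real, Real.norm_eq_abs]
      have := csch_sin_le p.2 p.1
      calc _ ≤ (|p.2| * |Kker p.1|) * ‖g p.2‖ := mul_le_mul_of_nonneg_right this (norm_nonneg _)
        _ = _ := by ring
  set W : ℝ → ℂ := fun t => ∫ x : ℝ, Ψ t x with hW
  have hWi : Integrable W := hΨi.integral_prod_left
  have hWint : ∫ t, W t = 2 * ∫ x : ℝ, Complex.exp (-(Complex.I * (x : ℂ) * (ξ : ℂ))) *
      ((Real.tanh x : ℂ) * g x) := by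
    rw [hW, integral_integral_swap hΨi, ← integral_const_mul]
    apply integral_congr_ae
    refine Eventually.of_forall fun x => ?_
    simp only [hΨ]
    have hcs : (∫ a : ℝ, ((csch (Real.pi * a / 2) * Real.sin (x * a) : ℝ) : ℂ)) =
        ((2 * Real.tanh x : ℝ) : ℂ) := by
      rw [← csch_sin_integral x]; exact integral_ofReal
    rw [integral_mul_const, hcs]
    push_cast
    ring
  have hGdiff : ∀ t : ℝ, (csch (Real.pi * t / 2) : ℂ) * (G (ξ - t) - G (ξ + t)) =
      2 * Complex.I * c * W t := by
    intro t
    have e : G (ξ - t) - G (ξ + t) = c * ∫ x : ℝ, (2 * Complex.I * (Real.sin (x * t) : ℂ)) *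
        (Complex.exp (-(Complex.I * (x : ℂ) * (ξ : ℂ))) * g x) := by
      rw [hG]
      unfold FT
      rw [← mul_sub, ← integral_sub (FT_integrand_integrable g.integrable _)
        (FT_integrand_integrable g.integrable _)]
      congr 1
      apply integral_congr_ae
      refine Eventually.of_forall fun x => ?_
      simp only []
      have hs : 2 * Complex.I * (Real.sin (x * t) : ℂ) = Complex.exp (Complex.I * x * t) -
          Complex.exp (-(Complex.I * x * t)) := by
        rw [Complex.ofReal_sin, Complex.sin]
        have hI : Complex.I * Complex.I = -1 := Complex.I_mul_I
        rw [show ((x * t : ℝ) : ℂ) * Complex.I = Complex.I * x * t by push_cast; ring,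
          show -((x * t : ℝ) : ℂ) * Complex.I = -(Complex.I * x * t) by push_cast; ring]
        linear_combination (Complex.exp (-(Complex.I * x * t)) - Complex.exp (Complex.I * x * t)) * hI
      rw [hs, show -(Complex.I * (x : ℂ) * ((ξ - t : ℝ) : ℂ)) = Complex.I * x * t +
        -(Complex.I * (x : ℂ) * ξ) by push_cast; ring,
        show -(Complex.I * (x : ℂ) * ((ξ + t : ℝ) : ℂ)) = -(Complex.I * x * t) +
        -(Complex.I * (x : ℂ) * ξ) by push_cast; ring, Complex.exp_add, Complex.exp_add]
      ring
    rw [e, hW]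
    simp only []
    rw [← integral_const_mul, ← integral_const_mul, ← integral_const_mul]
    apply integral_congr_ae
    refine Eventually.of_forall fun x => ?_
    simp only [hΨ]
    push_cast
    ring
  have key : ∀ δ : ℝ, 0 < δ → ∫ η in {η : ℝ | δ ≤ |ξ - η|},
        (csch (Real.pi * (ξ - η) / 2) : ℂ) * G η =
      (Complex.I * c) * ∫ t : ℝ, Set.indicator {t : ℝ | δ ≤ |t|} W t := by
    intro δ hδ
    set A : ℝ → ℂ := Set.indicator {t : ℝ | δ ≤ |t|}
      (fun t => (csch (Real.pi * t / 2) : ℂ) * G (ξ - t)) with hA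
    have hms : MeasurableSet {t : ℝ | δ ≤ |t|} :=
      measurableSet_le measurable_const (by fun_prop)
    have hms' : MeasurableSet {η : ℝ | δ ≤ |ξ - η|} :=
      measurableSet_le measurable_const (by fun_prop)
    have hAi : Integrable A := by
      have hb : Integrable (fun t => (4 / δ) * ‖G (ξ - t)‖) := (hGi.comp_sub_left ξ).norm.const_mul _
      refine hb.mono' ?_ (Eventually.of_forall fun t => ?_)
      · refine AEStronglyMeasurable.indicator ?_ hms
        refine AEStronglyMeasurable.mul ?_ (by fun_prop)
        exact (Complex.measurable_ofReal.comp
          (measurable_csch.comp (by fun_prop))).aestronglyMeasurable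
      · rw [hA]
        by_cases ht : δ ≤ |t|
        · rw [Set.indicator_of_mem (by exact ht), norm_mul, Complex.norm_real, Real.norm_eq_abs]
          refine mul_le_mul_of_nonneg_right ?_ (norm_nonneg _)
          have h1 := mul_csch_le t
          rw [abs_mul] at h1
          have h2 : (1 + t ^ 2)⁻¹ ≤ 1 := inv_le_one_of_one_le₀ (by nlinarith [sq_nonneg t])
          rw [le_div_iff₀ hδ]
          nlinarith [abs_nonneg (csch (Real.pi * t / 2))]
        · rw [Set.indicator_of_notMem (by exact ht), norm_zero]
          positivity
    have h1 : ∫ η in {η : ℝ | δ ≤ |ξ - η|}, (csch (Real.pi * (ξ - η) / 2) : ℂ) * G η = ∫ t, A t := by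
      rw [← integral_indicator hms', ← integral_sub_left_eq_self A volume ξ]
      apply integral_congr_ae
      refine Eventually.of_forall fun η => ?_
      simp only [hA, Set.indicator_apply, Set.mem_ofPred_eq, sub_sub_cancel]
    have h2 : ∫ t, A t = (1 / 2 : ℂ) * ∫ t, (A t + A (-t)) := by
      rw [integral_add hAi hAi.comp_neg, integral_neg_eq_self A volume]
      ring
    rw [h1, h2, ← integral_const_mul, ← integral_const_mul]
    apply integral_congr_ae
    refine Eventually.of_forall fun t => ?_
    simp only [hA, Set.indicator_apply, Set.mem_ofPred_eq, abs_neg, sub_neg_eq_add]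
    split_ifs with ht
    · have hodd : csch (Real.pi * (-t) / 2) = -csch (Real.pi * t / 2) := by
        unfold csch
        rw [show Real.pi * (-t) / 2 = -(Real.pi * t / 2) by ring, Real.sinh_neg]
        rw [div_neg]
      rw [hodd]
      have := hGdiff t
      push_cast
      linear_combination (1 / 2 : ℂ) * this
    · simp
  have hlim : Tendsto (fun δ : ℝ => ∫ t : ℝ, Set.indicator {t : ℝ | δ ≤ |t|} W t) (𝓝[>] (0:ℝ))
      (𝓝 (∫ t, W t)) := by
    refine tendsto_integral_filter_of_dominated_convergence (fun t => ‖W t‖) ?_ ?_ hWi.norm ?_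
    · refine Eventually.of_forall fun δ => hWi.aestronglyMeasurable.indicator ?_
      exact measurableSet_le measurable_const (by fun_prop)
    · exact Eventually.of_forall fun δ => Eventually.of_forall fun t => norm_indicator_le_norm_self _ _
    · have h0 : ∀ᵐ t : ℝ, t ≠ 0 := by simp [ae_iff]
      filter_upwards [h0] with t ht
      refine tendsto_const_nhds.congr' ?_
      have : ∀ᶠ δ : ℝ in 𝓝[>] (0:ℝ), δ < |t| :=
        mem_nhdsWithin_of_mem_nhds (Iio_mem_nhds (abs_pos.2 ht))
      filter_upwards [this] with δ hδ
      rw [Set.indicator_of_mem]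
      exact hδ.le
  have hfin := hlim.const_mul (Complex.I * c)
  rw [hWint] at hfin
  have e3 : 2 * Complex.I * FT (fun x => (Real.tanh x : ℂ) * g x) ξ = Complex.I * c * (2 * ∫ x : ℝ,
      Complex.exp (-(Complex.I * (x : ℂ) * (ξ : ℂ))) * ((Real.tanh x : ℂ) * g x)) := by
    unfold FT; ring
  rw [e3]
  refine hfin.congr' ?_
  filter_upwards [self_mem_nhdsWithin] with δ hδ
  exact (key δ hδ).symm

lemma tanh_mul_integrable (g : SchwartzMap ℝ ℂ) :
    Integrable (fun x : ℝ => (Real.tanh x : ℂ) * g x) := by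
  refine g.integrable.bdd_mul (c := 1) ?_ ?_
  · exact (Complex.continuous_ofReal.comp continuous_tanh').aestronglyMeasurable
  · refine Eventually.of_forall fun x => ?_
    rw [Complex.norm_real, Real.norm_eq_abs]
    exact abs_tanh_le x

lemma sech_sq_mul_integrable (g : SchwartzMap ℝ ℂ) :
    Integrable (fun x : ℝ => ((sech x ^ 2 : ℝ) : ℂ) * g x) := by
  refine g.integrable.bdd_mul (c := 1) ?_ ?_
  · exact (Complex.continuous_ofReal.comp (continuous_sech.pow 2)).aestronglyMeasurable
  · refine Eventually.of_forall fun x => ?_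
    rw [Complex.norm_real, Real.norm_eq_abs, abs_of_nonneg (by positivity)]
    exact pow_le_one₀ (sech_pos x).le (sech_le_one x)

/-- value at zero by Fourier inversion -/
lemma at_zero (h : SchwartzMap ℝ ℂ) :
    h 0 = (Real.sqrt (2 * Real.pi) : ℂ)⁻¹ * ∫ η : ℝ, FT (⇑h) η := by
  have := FT_inv_schwartz h 0
  simpa using this

lemma one_add_sq_ne (η : ℝ) : (1 + (η : ℂ) ^ 2) ≠ 0 := by
  have : (1 + η ^ 2 : ℝ) ≠ 0 := by positivity
  exact_mod_cast this

lemma four_add_sq_ne (η : ℝ) : (4 + (η : ℂ) ^ 2) ≠ 0 := by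
  have : (4 + η ^ 2 : ℝ) ≠ 0 := by positivity
  exact_mod_cast this

/-- The Fourier transform of `J[f]` for Schwartz `f`: integrability and the
principal-value formula. -/
theorem fourier_transform_J (f : SchwartzMap ℝ ℂ) :
    Integrable (Jop ⇑f) ∧
      ∀ ξ : ℝ,
        Tendsto
          (fun δ : ℝ => ∫ η in {η : ℝ | δ ≤ |ξ - η|},
            (m5 η : ℂ) * (csch (Real.pi * (ξ - η) / 2) : ℂ) * FT (⇑f) η)
          (𝓝[>] (0 : ℝ))
          (𝓝 (FT (Jop ⇑f) ξ - (m4 ξ : ℂ) * FT (⇑f) ξ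
            - (∫ η : ℝ, (Kker (ξ - η) : ℂ) * (m6 η : ℂ) * FT (⇑f) η)
            - (Kker ξ : ℂ) * (∫ η : ℝ, (m2 η : ℂ) * FT (⇑f) η)
            - ((ξ * sech (Real.pi * ξ / 2) : ℝ) : ℂ) * ∫ η : ℝ, (m3 η : ℂ) * FT (⇑f) η)) := by
  obtain ⟨h, hh⟩ := exists_h f
  have hf := f_eq_h f h hh
  set C1 : ℂ := h 0 - Dop (Dop h) 0 with hC1
  set C2 : ℂ := 4 * Dop h 0 - Dop (Dop (Dop h)) 0 with hC2
  have hJ : Jop ⇑f = fun x => Dop (Dop h) x + (2 * h x + (-3 * (((sech x ^ 2 : ℝ) : ℂ) * h x) +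
      (-3 * ((Real.tanh x : ℂ) * Dop h x) + (C1 * ((sech x ^ 2 : ℝ) : ℂ) +
        C2 * ((sech x * Real.tanh x : ℝ) : ℂ))))) := by
    funext x
    rw [Jop_formula f h hf x]
    ring
  have i1 : Integrable (fun x => Dop (Dop h) x) := (Dop (Dop h)).integrable
  have i2 : Integrable (fun x => 2 * h x) := h.integrable.const_mul 2
  have i3 : Integrable (fun x => -3 * (((sech x ^ 2 : ℝ) : ℂ) * h x)) :=
    (sech_sq_mul_integrable h).const_mul (-3)
  have i4 : Integrable (fun x => -3 * ((Real.tanh x : ℂ) * Dop h x)) :=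
    (tanh_mul_integrable (Dop h)).const_mul (-3)
  have i5 : Integrable (fun x : ℝ => C1 * ((sech x ^ 2 : ℝ) : ℂ)) :=
    integrable_sech_sq.ofReal.const_mul C1
  have i6 : Integrable (fun x : ℝ => C2 * ((sech x * Real.tanh x : ℝ) : ℂ)) :=
    integrable_sech_tanh.ofReal.const_mul C2
  have i56 := i5.add i6
  have i46 := i4.add i56
  have i36 := i3.add i46
  have i26 := i2.add i36
  refine ⟨?_, fun ξ => ?_⟩
  · rw [hJ]
    exact i1.add i26
  have hs := sqrt_two_pi_ne
  have hs2 := sqrt_two_pi_sq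
  have hI : Complex.I * Complex.I = -1 := Complex.I_mul_I
  have hpi : (Real.pi : ℂ) ≠ 0 := by exact_mod_cast Real.pi_ne_zero
  set c : ℂ := (Real.sqrt (2 * Real.pi) : ℂ)⁻¹ with hc
  have hcc : c * c * Real.pi * 2 = 1 := by
    rw [hc, ← mul_inv, hs2]
    field_simp
  have hFT : FT (Jop ⇑f) ξ = FT (⇑(Dop (Dop h))) ξ + (2 * FT (⇑h) ξ +
      (-3 * FT (fun x => ((sech x ^ 2 : ℝ) : ℂ) * h x) ξ +
      (-3 * FT (fun x => (Real.tanh x : ℂ) * Dop h x) ξ +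
      (C1 * (c * (Real.pi * Kker ξ)) +
        C2 * (-(Complex.I * ξ * (c * (Real.pi * sech (Real.pi * ξ / 2)))))))))  := by
    rw [hJ]
    have a1 := FT_add' i1 i26 ξ
    have a2 := FT_add' i2 i36 ξ
    have a3 := FT_add' i3 i46 ξ
    have a4 := FT_add' i4 i56 ξ
    have a5 := FT_add' i5 i6 ξ
    rw [FT_const_mul', FT_const_mul', FT_sech_sq, FT_sech_tanh] at a5
    rw [FT_const_mul'] at a2 a3 a4
    refine a1.trans ?_
    congr 1
    refine a2.trans ?_
    congr 1
    refine a3.trans ?_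
    congr 1
    refine a4.trans ?_
    congr 1
  have hm4 : (m4 ξ : ℂ) * FT (⇑f) ξ = FT (⇑(Dop (Dop h))) ξ + 2 * FT (⇑h) ξ := by
    rw [hh ξ, FT_Dop, FT_Dop]
    have h1 := one_add_sq_ne ξ
    have h4 := four_add_sq_ne ξ
    unfold m4
    push_cast
    field_simp
    linear_combination (-(ξ : ℂ) ^ 2 * FT (⇑h) ξ) * hI
  have hm6 : (∫ η : ℝ, (Kker (ξ - η) : ℂ) * (m6 η : ℂ) * FT (⇑f) η) =
      -3 * FT (fun x => ((sech x ^ 2 : ℝ) : ℂ) * h x) ξ := by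
    rw [FT_sech_sq_mul, ← mul_assoc, ← integral_const_mul]
    apply integral_congr_ae
    refine Eventually.of_forall fun η => ?_
    have h1 := one_add_sq_ne η
    have h4 := four_add_sq_ne η
    simp only [hh η]
    unfold m6
    push_cast
    field_simp
  have hm2 : C1 = 2 * c * ∫ η : ℝ, (m2 η : ℂ) * FT (⇑f) η := by
    rw [hC1, at_zero h, at_zero (Dop (Dop h)), ← hc, ← mul_sub, ← integral_sub
      (FT_schwartz_integrable h) (FT_schwartz_integrable _), mul_comm 2 c, mul_assoc c 2,
      ← integral_const_mul (2 : ℂ)]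
    congr 1
    apply integral_congr_ae
    refine Eventually.of_forall fun η => ?_
    have h1 := one_add_sq_ne η
    have h4 := four_add_sq_ne η
    simp only [hh η, FT_Dop]
    unfold m2
    push_cast
    field_simp
    linear_combination (-(η : ℂ) ^ 2 * FT (⇑h) η) * hI
  have hm3 : C2 = 2 * Complex.I * c * ∫ η : ℝ, (m3 η : ℂ) * FT (⇑f) η := by
    rw [hC2, at_zero (Dop h), at_zero (Dop (Dop (Dop h))), ← hc, mul_left_comm, ← mul_sub,
      ← integral_const_mul (4 : ℂ), ← integral_sub
      ((FT_schwartz_integrable (Dop h)).const_mul 4) (FT_schwartz_integrable _),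
      mul_comm (2 * Complex.I) c, mul_assoc c,
      ← integral_const_mul (2 * Complex.I : ℂ)]
    congr 1
    apply integral_congr_ae
    refine Eventually.of_forall fun η => ?_
    have h1 := one_add_sq_ne η
    have h4 := four_add_sq_ne η
    simp only [hh η, FT_Dop]
    unfold m3
    push_cast
    field_simp
    linear_combination (-(η : ℂ) ^ 3 * FT (⇑h) η) * hI
  have hPV := (PV_tanh (Dop h) ξ).const_mul (3 * Complex.I / 2)
  have hval : FT (Jop ⇑f) ξ - (m4 ξ : ℂ) * FT (⇑f) ξ
            - (∫ η : ℝ, (Kker (ξ - η) : ℂ) * (m6 η : ℂ) * FT (⇑f) η)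
            - (Kker ξ : ℂ) * (∫ η : ℝ, (m2 η : ℂ) * FT (⇑f) η)
            - ((ξ * sech (Real.pi * ξ / 2) : ℝ) : ℂ) * (∫ η : ℝ, (m3 η : ℂ) * FT (⇑f) η) =
      3 * Complex.I / 2 * (2 * Complex.I * FT (fun x => (Real.tanh x : ℂ) * Dop h x) ξ) := by
    rw [hm6, hm4, hFT, hm2, hm3, Complex.ofReal_mul]
    set A := ∫ η : ℝ, (m2 η : ℂ) * FT (⇑f) η
    set B := ∫ η : ℝ, (m3 η : ℂ) * FT (⇑f) η
    set T := FT (fun x => (Real.tanh x : ℂ) * Dop h x) ξ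
    linear_combination (A * Kker ξ + B * ξ * sech (Real.pi * ξ / 2)) * hcc - (3 * T +
      2 * c * c * Real.pi * B * ξ * sech (Real.pi * ξ / 2)) * hI
  rw [hval]
  refine hPV.congr fun δ => ?_
  rw [← integral_const_mul]
  apply integral_congr_ae
  refine Eventually.of_forall fun η => ?_
  have h1 := one_add_sq_ne η
  have h4 := four_add_sq_ne η
  simp only [hh η, FT_Dop]
  unfold m5
  push_cast
  field_simp
  linear_combination ((csch (Real.pi * (ξ - η) / 2) : ℂ) * η * FT (⇑h) η) * hI
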